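/- arXiv:1001.2431 — 4 statements merged into one kernel-verified Lean document; each statement's English description precedes it below -/
import Mathlib

section
/- Let (η_j)_{j≥1} be a sequence of pairwise distinct complex numbers. Then for every entire function f : ℂ² → ℂ, every N ≥ 1, and every z ∈ ℂ², one has the identity f(z) = E_N(f;η)(z) − R_N(f;η)(z) + Σ_{k+l≥N} a_{k,l} z_1^k z_2^l, where (a_{k,l}) are the Taylor coefficients of f at 0. -/
open Complex Filter

/-- Divided differences: `divDiff η g p w` is `Δ_{p,(η_p,…,η_1)}(g)(w)`. -/
noncomputable def divDiff (η : ℕ → ℂ) (g : ℂ → ℂ) : ℕ → ℂ → ℂ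
  | 0, w => g w
  | p + 1, w => (divDiff η g p w - divDiff η g p (η (p + 1))) / (w - η (p + 1))

/-- The interpolation formula `E_N(f;η)(z)`. -/
noncomputable def EN (η : ℕ → ℂ) (f : ℂ × ℂ → ℂ) (N : ℕ) (z : ℂ × ℂ) : ℂ :=
  ∑ p ∈ Finset.Icc 1 N,
    (∏ j ∈ Finset.Icc (p + 1) N, (z.1 - η j * z.2)) *
      ∑ q ∈ Finset.Icc p N,
        ((1 + η p * (starRingEnd ℂ) (η q)) / (1 + (Complex.normSq (η q) : ℂ))) *
          (∏ j ∈ (Finset.Icc p N).erase q, (η q - η j))⁻¹ *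
            ∑' m : ℕ,
              ((z.2 + (starRingEnd ℂ) (η q) * z.1) / (1 + (Complex.normSq (η q) : ℂ))) ^ m *
                (((m + (N - p)).factorial : ℂ))⁻¹ *
                  iteratedDeriv (m + (N - p)) (fun v => f (η q * v, v)) 0

/-- The remainder formula `R_N(f;η)(z)`, expressed via the Taylor coefficients `a` of `f`. -/
noncomputable def RN (η : ℕ → ℂ) (a : ℕ → ℕ → ℂ) (N : ℕ) (z : ℂ × ℂ) : ℂ :=
  ∑ p ∈ Finset.Icc 1 N,
    (∏ j ∈ (Finset.Icc 1 N).erase p, ((z.1 - η j * z.2) / (η p - η j))) *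
      ∑' kl : ℕ × ℕ,
        if N ≤ kl.1 + kl.2 then
          a kl.1 kl.2 * η p ^ kl.1 *
            ((z.2 + (starRingEnd ℂ) (η p) * z.1) /
                (1 + (Complex.normSq (η p) : ℂ))) ^ (kl.1 + kl.2 - N + 1)
        else 0


lemma aux_lagrange (s : Finset ℕ) (η : ℕ → ℂ) (hs : Set.InjOn η s) (d k : ℕ) (hk : k ≤ d)
    (hc : s.card = d + 1) (x y : ℂ) :
    ∑ q ∈ s, (∏ j ∈ s.erase q, ((x - η j * y) / (η q - η j))) * η q ^ k = x ^ k * y ^ (d - k) := by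
  have key : (fun y : ℂ => ∑ q ∈ s, (∏ j ∈ s.erase q, ((x - η j * y) / (η q - η j))) * η q ^ k)
      = fun y => x ^ k * y ^ (d - k) := by
    apply Continuous.ext_on (dense_compl_singleton (0 : ℂ))
    · fun_prop
    · fun_prop
    · intro y hy
      have hy : y ≠ 0 := hy
      have h := Lagrange.eq_interpolate (s := s) (v := η) (f := (Polynomial.X : Polynomial ℂ) ^ k) hs
        (by rw [Polynomial.degree_X_pow, hc]; exact_mod_cast Nat.lt_succ_of_le hk)
      have h2 := congrArg (Polynomial.eval (x / y)) h
      simp only [Polynomial.eval_pow, Polynomial.eval_X, Lagrange.interpolate_apply,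
        Polynomial.eval_finsetSum, Polynomial.eval_mul, Polynomial.eval_C, Lagrange.basis,
        Polynomial.eval_prod, Lagrange.basisDivisor, Polynomial.eval_sub] at h2
      have h3 : x ^ k * y ^ (d - k) = (x / y) ^ k * y ^ d := by
        rw [div_pow, div_mul_eq_mul_div, eq_div_iff (pow_ne_zero _ hy), mul_assoc, ← pow_add,
          Nat.sub_add_cancel hk]
      simp only []
      rw [h3, h2, Finset.sum_mul]
      refine Finset.sum_congr rfl fun q hq => ?_
      have hce : (s.erase q).card = d := by rw [Finset.card_erase_of_mem hq, hc]; rfl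
      rw [mul_right_comm, mul_assoc, mul_comm, ]
      congr 1
      rw [mul_comm, ← hce, ← Finset.prod_const, ← Finset.prod_mul_distrib]
      refine Finset.prod_congr rfl fun j _ => ?_
      field_simp
  exact congrFun key y

noncomputable def auxC (η : ℕ → ℂ) (N : ℕ) (x y : ℂ) (p q : ℕ) : ℂ :=
  (∏ j ∈ Finset.Icc (p + 1) N, (x - η j * y)) *
    (((1 + η p * (starRingEnd ℂ) (η q)) / (1 + (Complex.normSq (η q) : ℂ))) *
          (∏ j ∈ (Finset.Icc p N).erase q, (η q - η j))⁻¹)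

noncomputable def auxW (η : ℕ → ℂ) (x y : ℂ) (q : ℕ) : ℂ :=
  (y + (starRingEnd ℂ) (η q) * x) / (1 + (Complex.normSq (η q) : ℂ))

lemma aux_D (t : ℂ) : (1 + (Complex.normSq t : ℂ)) ≠ 0 := by
  have : (0:ℝ) < 1 + Complex.normSq t := by have := Complex.normSq_nonneg t; linarith
  exact_mod_cast this.ne'

lemma aux_step (u t x y : ℂ) (h : t - u ≠ 0) :
    (x - u * y) / (t - u) = (x - t * y) * ((1 + u * (starRingEnd ℂ) t) / (1 + (Complex.normSq t : ℂ)))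
      / (t - u) + (y + (starRingEnd ℂ) t * x) / (1 + (Complex.normSq t : ℂ)) := by
  have hD := aux_D t
  rw [← Complex.mul_conj] at *
  field_simp
  ring

lemma aux_tele (η : ℕ → ℂ) (hdist : ∀ i j, 1 ≤ i → 1 ≤ j → i ≠ j → η i ≠ η j)
    (N : ℕ) (x y : ℂ) (q : ℕ) (hq : q ≤ N) (n : ℕ) : ∀ P, 1 ≤ P → q = P + n →
    ∑ p ∈ Finset.Icc P q, auxC η N x y p q * auxW η x y q ^ (p - P) =
      ∏ j ∈ (Finset.Icc P N).erase q, ((x - η j * y) / (η q - η j)) := by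
  induction n with
  | zero =>
    intro P hP h
    obtain rfl : q = P := h
    have he : (Finset.Icc q N).erase q = Finset.Icc (q + 1) N := by
      ext j; simp only [Finset.mem_erase, Finset.mem_Icc]; omega
    simp only [Finset.Icc_self, Finset.sum_singleton, Nat.sub_self, pow_zero, mul_one, auxC, he,
      Finset.prod_div_distrib, Complex.mul_conj]
    rw [div_self (aux_D _), one_mul, div_eq_mul_inv]
  | succ n ih =>
    intro P hP h
    have ih := ih (P + 1) (by omega) (by omega)
    have hne : η q - η P ≠ 0 := sub_ne_zero.2 (hdist _ _ (by omega) hP (by omega))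
    have he : (Finset.Icc P N).erase q = insert P ((Finset.Icc (P + 1) N).erase q) := by
      ext j; simp only [Finset.mem_erase, Finset.mem_Icc, Finset.mem_insert]; omega
    have hnm : P ∉ (Finset.Icc (P + 1) N).erase q := by simp
    have hmem : q ∈ Finset.Icc (P + 1) N := by simp only [Finset.mem_Icc]; omega
    have hI : Finset.Icc P q = insert P (Finset.Icc (P + 1) q) := by
      ext j; simp only [Finset.mem_Icc, Finset.mem_insert]; omega
    rw [hI, Finset.sum_insert (by simp), he, Finset.prod_insert hnm]
    have h1 : ∑ p ∈ Finset.Icc (P + 1) q, auxC η N x y p q * auxW η x y q ^ (p - P) =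
        auxW η x y q * ∑ p ∈ Finset.Icc (P + 1) q, auxC η N x y p q * auxW η x y q ^ (p - (P + 1)) := by
      rw [Finset.mul_sum]
      refine Finset.sum_congr rfl fun p hp => ?_
      rw [Finset.mem_Icc] at hp
      rw [show p - P = p - (P + 1) + 1 by omega, pow_succ]; ring
    rw [h1, ih, aux_step _ _ _ _ hne, add_mul]
    congr 1
    rw [auxC, he, Finset.prod_insert hnm, ← Finset.mul_prod_erase _ _ hmem, Finset.prod_div_distrib,
      mul_inv]
    simp only [div_eq_mul_inv, Nat.sub_self, pow_zero]
    ring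

noncomputable def auxG (η : ℕ → ℂ) (a : ℕ → ℕ → ℂ) (q m : ℕ) : ℂ :=
  ∑ kl ∈ Finset.HasAntidiagonal.antidiagonal m, a kl.1 kl.2 * η q ^ kl.1

lemma aux_antidiag (F : ℕ × ℕ → ℂ) (s : ℂ) (h : HasSum F s) :
    HasSum (fun m => ∑ kl ∈ Finset.HasAntidiagonal.antidiagonal m, F kl) s := by
  have h2 := (Finset.HasAntidiagonal.sigmaAntidiagonalEquivProd (A := ℕ)).hasSum_iff.2 h
  refine h2.sigma fun m => ?_
  have := hasSum_fintype (fun c : Finset.HasAntidiagonal.antidiagonal m => F c.1)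
  rw [Finset.sum_coe_sort (Finset.HasAntidiagonal.antidiagonal m) F] at this
  exact this

lemma aux_hasSumG (η : ℕ → ℂ) (f : ℂ × ℂ → ℂ) (a : ℕ → ℕ → ℂ)
    (ha : ∀ z : ℂ × ℂ,
      HasSum (fun kl : ℕ × ℕ => a kl.1 kl.2 * z.1 ^ kl.1 * z.2 ^ kl.2) (f z)) (q : ℕ) (v : ℂ) :
    HasSum (fun m => auxG η a q m * v ^ m) (f (η q * v, v)) := by
  have h := aux_antidiag _ _ (ha (η q * v, v))
  convert h using 2 with m
  rw [auxG, Finset.sum_mul]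
  refine Finset.sum_congr rfl fun kl hkl => ?_
  rw [← Finset.HasAntidiagonal.mem_antidiagonal.1 hkl, pow_add, mul_pow]; ring

lemma aux_deriv (g : ℂ → ℂ) (c : ℕ → ℂ) (h : ∀ v, HasSum (fun m => c m * v ^ m) (g v)) (m : ℕ) :
    ((m.factorial : ℂ))⁻¹ * iteratedDeriv m g 0 = c m := by
  have hp : HasFPowerSeriesAt g (FormalMultilinearSeries.ofScalars ℂ c) 0 := by
    rw [hasFPowerSeriesAt_iff]
    refine Filter.Eventually.of_forall fun v => ?_
    simpa [FormalMultilinearSeries.coeff_ofScalars, mul_comm] using h v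
  have h2 := hp.eq_formalMultilinearSeries hp.analyticAt.hasFPowerSeriesAt
  have h3 := congrArg (fun p => FormalMultilinearSeries.coeff p m) h2
  simp only [FormalMultilinearSeries.coeff_ofScalars] at h3
  rw [h3]; field_simp

noncomputable def auxS (c : ℕ → ℂ) (w : ℂ) (n : ℕ) : ℂ := ∑' m : ℕ, w ^ m * c (m + n)

lemma aux_summ (c : ℕ → ℂ) (h : ∀ v, Summable (fun m => c m * v ^ m)) (w : ℂ) (n : ℕ) :
    Summable (fun m => w ^ m * c (m + n)) := by
  by_cases hw : w = 0
  · subst hw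
    apply summable_of_ne_finset_zero (s := {0})
    intro b hb
    simp only [Finset.mem_singleton] at hb
    simp [hb]
  · have := ((summable_nat_add_iff n).2 (h w)).mul_left ((w ^ n)⁻¹)
    refine (summable_congr fun m => ?_).2 this
    rw [pow_add]; field_simp

lemma aux_rec (c : ℕ → ℂ) (h : ∀ v, Summable (fun m => c m * v ^ m)) (w : ℂ) (n : ℕ) :
    auxS c w n = w * auxS c w (n + 1) + c n := by
  rw [auxS, (aux_summ c h w n).tsum_eq_zero_add, auxS, ← tsum_mul_left, add_comm]
  congr 1
  · refine tsum_congr fun m => ?_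
    rw [show m + 1 + n = m + (n + 1) by ring]; ring
  · simp

lemma aux_iter (c : ℕ → ℂ) (h : ∀ v, Summable (fun m => c m * v ^ m)) (w : ℂ) (N p : ℕ)
    (hp : p ≤ N) : auxS c w (N - p) = w ^ p * auxS c w N +
      ∑ P ∈ Finset.Icc 1 p, w ^ (p - P) * c (N - P) := by
  induction p with
  | zero => simp
  | succ p ih =>
    rw [aux_rec c h, show N - (p + 1) + 1 = N - p by omega, ih (by omega),
      Finset.sum_Icc_succ_top (by omega), mul_add, Finset.mul_sum, Nat.sub_self, pow_zero, one_mul,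
      pow_succ']
    rw [← add_assoc, ← mul_assoc]
    congr 2
    refine Finset.sum_congr rfl fun P hP => ?_
    rw [Finset.mem_Icc] at hP
    rw [show p + 1 - P = p - P + 1 by omega]; ring

lemma aux_RN (η : ℕ → ℂ) (f : ℂ × ℂ → ℂ) (a : ℕ → ℕ → ℂ)
    (ha : ∀ z : ℂ × ℂ,
      HasSum (fun kl : ℕ × ℕ => a kl.1 kl.2 * z.1 ^ kl.1 * z.2 ^ kl.2) (f z)) (q N : ℕ) (w : ℂ) :
    (∑' kl : ℕ × ℕ, if N ≤ kl.1 + kl.2 then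
          a kl.1 kl.2 * η q ^ kl.1 * w ^ (kl.1 + kl.2 - N + 1) else 0)
      = w * auxS (auxG η a q) w N := by
  by_cases hw : w = 0
  · subst hw; simp
  have hs : Summable (fun kl : ℕ × ℕ => if N ≤ kl.1 + kl.2 then
          a kl.1 kl.2 * η q ^ kl.1 * w ^ (kl.1 + kl.2 - N + 1) else 0) := by
    have h1 := ((ha (η q * w, w)).summable.mul_left (w * (w ^ N)⁻¹)).indicator
      {kl : ℕ × ℕ | N ≤ kl.1 + kl.2}
    refine (summable_congr fun kl => ?_).2 h1
    rw [Set.indicator_apply]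
    simp only [Set.mem_setOf_eq]
    split_ifs with hk
    · have : w ^ kl.1 * w ^ kl.2 = w ^ (kl.1 + kl.2 - N) * w ^ N := by
        rw [← pow_add, ← pow_add, Nat.sub_add_cancel hk]
      rw [mul_pow, pow_succ]
      have h2 : w * (w ^ N)⁻¹ * (a kl.1 kl.2 * (η q ^ kl.1 * w ^ kl.1) * w ^ kl.2) =
        w * (w ^ N)⁻¹ * a kl.1 kl.2 * η q ^ kl.1 * (w ^ kl.1 * w ^ kl.2) := by ring
      rw [h2, this]; field_simp
    · rfl
  have h2 := aux_antidiag _ _ hs.hasSum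
  have h3 : ∀ m, (∑ kl ∈ Finset.HasAntidiagonal.antidiagonal m, if N ≤ kl.1 + kl.2 then
          a kl.1 kl.2 * η q ^ kl.1 * w ^ (kl.1 + kl.2 - N + 1) else 0) =
          if N ≤ m then auxG η a q m * w ^ (m - N + 1) else 0 := by
    intro m
    rw [auxG, Finset.sum_mul]
    split_ifs with hm
    · refine Finset.sum_congr rfl fun kl hkl => ?_
      rw [Finset.HasAntidiagonal.mem_antidiagonal.1 hkl, if_pos hm]
    · refine Finset.sum_eq_zero fun kl hkl => ?_
      rw [Finset.HasAntidiagonal.mem_antidiagonal.1 hkl, if_neg hm]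
  simp only [h3] at h2
  rw [← h2.tsum_eq, ← h2.summable.sum_add_tsum_nat_add N, Finset.sum_eq_zero, zero_add, auxS,
    ← tsum_mul_left]
  · refine tsum_congr fun m => ?_
    rw [if_pos (by omega), Nat.add_sub_cancel, pow_succ]; ring
  · intro m hm
    rw [Finset.mem_range] at hm
    rw [if_neg (by omega)]

lemma aux_split (f : ℂ × ℂ → ℂ) (a : ℕ → ℕ → ℂ)
    (ha : ∀ z : ℂ × ℂ,
      HasSum (fun kl : ℕ × ℕ => a kl.1 kl.2 * z.1 ^ kl.1 * z.2 ^ kl.2) (f z)) (N : ℕ) (z : ℂ × ℂ) :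
    f z = ∑ P ∈ Finset.Icc 1 N, ∑ kl ∈ Finset.HasAntidiagonal.antidiagonal (N - P),
        a kl.1 kl.2 * z.1 ^ kl.1 * z.2 ^ kl.2 +
      ∑' kl : ℕ × ℕ,
        if N ≤ kl.1 + kl.2 then a kl.1 kl.2 * z.1 ^ kl.1 * z.2 ^ kl.2 else 0 := by
  set F : ℕ × ℕ → ℂ := fun kl => a kl.1 kl.2 * z.1 ^ kl.1 * z.2 ^ kl.2 with hF
  have hs : Summable (fun kl : ℕ × ℕ => if N ≤ kl.1 + kl.2 then F kl else 0) := by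
    have h1 := (ha z).summable.indicator {kl : ℕ × ℕ | N ≤ kl.1 + kl.2}
    refine (summable_congr fun kl => ?_).2 h1
    rw [Set.indicator_apply]; rfl
  have h1 := aux_antidiag _ _ (ha z)
  have h2 := aux_antidiag _ _ hs.hasSum
  have h3 := (h1.sub h2)
  have h4 : HasSum (fun m => ∑ kl ∈ Finset.HasAntidiagonal.antidiagonal m, F kl -
      ∑ kl ∈ Finset.HasAntidiagonal.antidiagonal m, if N ≤ kl.1 + kl.2 then F kl else 0)
      (∑ m ∈ Finset.range N, (∑ kl ∈ Finset.HasAntidiagonal.antidiagonal m, F kl -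
      ∑ kl ∈ Finset.HasAntidiagonal.antidiagonal m, if N ≤ kl.1 + kl.2 then F kl else 0)) := by
    apply hasSum_sum_of_ne_finset_zero
    intro m hm
    rw [Finset.mem_range, not_lt] at hm
    rw [sub_eq_zero]
    refine Finset.sum_congr rfl fun kl hkl => ?_
    rw [if_pos (by rw [Finset.HasAntidiagonal.mem_antidiagonal.1 hkl]; exact hm)]
  have h5 := h3.unique h4
  rw [sub_eq_iff_eq_add] at h5
  rw [h5]
  congr 1
  refine Finset.sum_bij' (fun m _ => N - m) (fun P _ => N - P) ?_ ?_ ?_ ?_ ?_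
  · intro m hm; simp only [Finset.mem_range, Finset.mem_Icc] at *; omega
  · intro m hm; simp only [Finset.mem_range, Finset.mem_Icc] at *; omega
  · intro m hm; simp only [Finset.mem_range, Finset.mem_Icc] at *; omega
  · intro m hm; simp only [Finset.mem_range, Finset.mem_Icc] at *; omega
  · intro m hm
    rw [Finset.mem_range] at hm
    rw [Nat.sub_sub_self hm.le, sub_eq_self]
    refine Finset.sum_eq_zero fun kl hkl => ?_
    rw [Finset.HasAntidiagonal.mem_antidiagonal.1 hkl, if_neg (by omega)]

theorem stmt4 (η : ℕ → ℂ)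
    (hdist : ∀ i j, 1 ≤ i → 1 ≤ j → i ≠ j → η i ≠ η j)
    (f : ℂ × ℂ → ℂ) (hf : Differentiable ℂ f)
    (a : ℕ → ℕ → ℂ)
    (ha : ∀ z : ℂ × ℂ,
      HasSum (fun kl : ℕ × ℕ => a kl.1 kl.2 * z.1 ^ kl.1 * z.2 ^ kl.2) (f z))
    (N : ℕ) (hN : 1 ≤ N) (z : ℂ × ℂ) :
    f z = EN η f N z - RN η a N z +
      ∑' kl : ℕ × ℕ,
        if N ≤ kl.1 + kl.2 then a kl.1 kl.2 * z.1 ^ kl.1 * z.2 ^ kl.2 else 0 := by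
  have hG := aux_hasSumG η f a ha
  have hS : ∀ q v, Summable (fun m => auxG η a q m * v ^ m) := fun q v => (hG q v).summable
  obtain ⟨x, y⟩ := z
  have hE : EN η f N (x, y) = ∑ p ∈ Finset.Icc 1 N, ∑ q ∈ Finset.Icc p N,
      auxC η N x y p q * auxS (auxG η a q) (auxW η x y q) (N - p) := by
    rw [EN]
    refine Finset.sum_congr rfl fun p hp => ?_
    rw [Finset.mul_sum]
    refine Finset.sum_congr rfl fun q hq => ?_
    rw [auxC]
    rw [← mul_assoc]
    refine congrArg _ ?_
    rw [auxS]
    refine tsum_congr fun m => ?_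
    rw [mul_assoc, aux_deriv _ _ (hG q)]; rfl
  have hswap : ∀ A : ℕ → ℕ → ℂ, ∀ M, ∑ p ∈ Finset.Icc M N, ∑ q ∈ Finset.Icc p N, A p q =
      ∑ q ∈ Finset.Icc M N, ∑ p ∈ Finset.Icc M q, A p q := by
    intro A M
    apply Finset.sum_comm'
    intro p q; simp only [Finset.mem_Icc]; omega
  have hT : ∀ P q, 1 ≤ P → P ≤ q → q ≤ N →
      ∑ p ∈ Finset.Icc P q, auxC η N x y p q * auxW η x y q ^ (p - P) =
      ∏ j ∈ (Finset.Icc P N).erase q, ((x - η j * y) / (η q - η j)) := fun P q h1 h2 h3 =>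
    aux_tele η hdist N x y q h3 (q - P) P h1 (by omega)
  have hR : RN η a N (x, y) = ∑ q ∈ Finset.Icc 1 N, ∑ p ∈ Finset.Icc 1 q,
      auxC η N x y p q * (auxW η x y q ^ p * auxS (auxG η a q) (auxW η x y q) N) := by
    rw [RN]
    refine Finset.sum_congr rfl fun q hq => ?_
    rw [Finset.mem_Icc] at hq
    have := aux_RN η f a ha q N (auxW η x y q)
    simp only [auxW] at this
    simp only []
    rw [this, ← hT 1 q le_rfl hq.1 hq.2, Finset.sum_mul]
    refine Finset.sum_congr rfl fun p hp => ?_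
    rw [Finset.mem_Icc] at hp
    obtain ⟨p, rfl⟩ := Nat.exists_eq_add_of_le' hp.1
    rw [Nat.add_sub_cancel, pow_succ]
    simp only [auxW]
    ring
  have hL : EN η f N (x, y) - RN η a N (x, y) = ∑ P ∈ Finset.Icc 1 N,
      ∑ kl ∈ Finset.HasAntidiagonal.antidiagonal (N - P), a kl.1 kl.2 * x ^ kl.1 * y ^ kl.2 := by
    rw [hE, hR, hswap, ← Finset.sum_sub_distrib]
    have h1 : ∀ q ∈ Finset.Icc 1 N, (∑ p ∈ Finset.Icc 1 q,
        auxC η N x y p q * auxS (auxG η a q) (auxW η x y q) (N - p) - ∑ p ∈ Finset.Icc 1 q,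
      auxC η N x y p q * (auxW η x y q ^ p * auxS (auxG η a q) (auxW η x y q) N)) =
      ∑ P ∈ Finset.Icc 1 q, (∏ j ∈ (Finset.Icc P N).erase q, ((x - η j * y) / (η q - η j))) *
        auxG η a q (N - P) := by
      intro q hq
      rw [Finset.mem_Icc] at hq
      rw [← Finset.sum_sub_distrib]
      have h2 : ∀ p ∈ Finset.Icc 1 q, auxC η N x y p q * auxS (auxG η a q) (auxW η x y q) (N - p) -
          auxC η N x y p q * (auxW η x y q ^ p * auxS (auxG η a q) (auxW η x y q) N) =
          ∑ P ∈ Finset.Icc 1 p, auxC η N x y p q * auxW η x y q ^ (p - P) * auxG η a q (N - P) := by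
        intro p hp
        rw [Finset.mem_Icc] at hp
        rw [aux_iter _ (hS q) _ N p (by omega), mul_add, add_sub_cancel_left, Finset.mul_sum]
        refine Finset.sum_congr rfl fun P _ => ?_
        ring
      rw [Finset.sum_congr rfl h2, Finset.sum_comm' (t' := Finset.Icc 1 q)
        (s' := fun P => Finset.Icc P q)]
      · refine Finset.sum_congr rfl fun P hP => ?_
        rw [Finset.mem_Icc] at hP
        rw [← hT P q hP.1 hP.2 hq.2, Finset.sum_mul]
      · intro p P; simp only [Finset.mem_Icc]; omega
    rw [Finset.sum_congr rfl h1, ← hswap (fun P q =>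
      (∏ j ∈ (Finset.Icc P N).erase q, ((x - η j * y) / (η q - η j))) * auxG η a q (N - P)) 1]
    refine Finset.sum_congr rfl fun P hP => ?_
    rw [Finset.mem_Icc] at hP
    simp only [auxG, Finset.mul_sum]
    rw [Finset.sum_comm]
    refine Finset.sum_congr rfl fun kl hkl => ?_
    have hkl := Finset.HasAntidiagonal.mem_antidiagonal.1 hkl
    have hl := aux_lagrange (Finset.Icc P N) η (by
      intro i hi j hj hij
      simp only [Finset.coe_Icc, Set.mem_Icc] at hi hj
      by_contra hne
      exact hdist i j (by omega) (by omega) hne hij) (N - P) kl.1 (by omega)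
      (by rw [Nat.card_Icc]; omega) x y
    rw [show N - P - kl.1 = kl.2 by omega] at hl
    rw [mul_assoc, ← hl, Finset.mul_sum]
    refine Finset.sum_congr rfl fun q _ => ?_
    ring
  rw [hL]
  exact aux_split f a ha N (x, y)
end

section
/- Let (η_j)_{j≥1} be a sequence of pairwise distinct complex numbers. Then for every N ≥ 1 and every polynomial P ∈ ℂ[z_1, z_2] of total degree at most N − 1, one has E_N(P;η)(z) = P(z) for all z ∈ ℂ²; i.e., the interpolation formula E_N fixes the polynomials of total degree at most N − 1. -/
open Complex Filter

/-- Divided difference of the values `F` at the first `i + 1` nodes. -/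
noncomputable def ddv (x F : ℕ → ℂ) (i : ℕ) : ℂ :=
  ∑ q ∈ Finset.range (i + 1), F q * (∏ j ∈ (Finset.range (i + 1)).erase q, (x q - x j))⁻¹

/-- Partial products. -/
noncomputable def Mpr (x : ℕ → ℂ) (s t : ℂ) (i : ℕ) : ℂ :=
  ∏ j ∈ Finset.range i, (s - x j * t)

/-- The degree `k` part of the formula. -/
noncomputable def Hk (x g : ℕ → ℂ) (s t : ℂ) (F : ℕ → ℂ) (k : ℕ) : ℂ :=
  ∑ i ∈ Finset.range (k + 1), Mpr x s t i *
    ddv x (fun q => (1 + (x i - x q) * g q) * ((t + g q * (s - x q * t)) ^ (k - i) * F q)) i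

lemma ddv_congr (x F G : ℕ → ℂ) (i : ℕ) (h : ∀ q ≤ i, F q = G q) : ddv x F i = ddv x G i := by
  unfold ddv
  refine Finset.sum_congr rfl fun q hq => ?_
  rw [h q (by simpa [Nat.lt_succ_iff] using hq)]

lemma ddv_add (x F G : ℕ → ℂ) (i : ℕ) :
    ddv x (fun q => F q + G q) i = ddv x F i + ddv x G i := by
  simp [ddv, add_mul, Finset.sum_add_distrib]

lemma ddv_smul (x F : ℕ → ℂ) (c : ℂ) (i : ℕ) :
    ddv x (fun q => c * F q) i = c * ddv x F i := by
  simp [ddv, Finset.mul_sum, mul_assoc]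

lemma ddv_shift (x F : ℕ → ℂ) (i : ℕ) (h : ∀ q ≤ i, x q ≠ x (i + 1)) :
    ddv x (fun q => (x q - x (i + 1)) * F q) (i + 1) = ddv x F i := by
  unfold ddv
  rw [Finset.sum_range_succ]
  simp only [sub_self, zero_mul, add_zero]
  refine Finset.sum_congr rfl fun q hq => ?_
  have hq' : q ≤ i := by simpa [Nat.lt_succ_iff] using hq
  have h0 : x q - x (i + 1) ≠ 0 := sub_ne_zero.mpr (h q hq')
  rw [Finset.range_add_one (n := i + 1), Finset.erase_insert_of_ne (by omega),
    Finset.prod_insert (by simp), mul_inv]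
  field_simp

lemma Hk_succ (x g : ℕ → ℂ) (s t : ℂ) (F : ℕ → ℂ) (k : ℕ)
    (h : ∀ i ≤ k + 1, ∀ q < i, x q ≠ x i) :
    Hk x g s t F (k + 1) = t * Hk x g s t F k + Mpr x s t (k + 1) * ddv x F (k + 1) := by
  set w : ℕ → ℂ := fun q => t + g q * (s - x q * t) with hw
  set X : ℕ → ℂ := fun i => Mpr x s t i * ddv x (fun q => w q ^ (k + 1 - i) * F q) i with hX
  have key : ∀ i ∈ Finset.range (k + 1), Mpr x s t (i + 1) *
      ddv x (fun q => (1 + (x (i + 1) - x q) * g q) * (w q ^ (k + 1 - (i + 1)) * F q)) (i + 1)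
      = (X (i + 1) - X i) + t * (Mpr x s t i *
        ddv x (fun q => (1 + (x i - x q) * g q) * (w q ^ (k - i) * F q)) i) := by
    intro i hi
    have hi' : i ≤ k := by simpa [Nat.lt_succ_iff] using hi
    have e1 : k + 1 - (i + 1) = k - i := by omega
    have e2 : k + 1 - i = (k - i) + 1 := by omega
    simp only [hX, e1, e2]
    have a1 : ddv x (fun q => (1 + (x (i + 1) - x q) * g q) * (w q ^ (k - i) * F q)) (i + 1)
        = ddv x (fun q => w q ^ (k - i) * F q) (i + 1)
          + (-1) * ddv x (fun q => g q * (w q ^ (k - i) * F q)) i := by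
      rw [← ddv_shift x _ i (fun q hq => h (i + 1) (by omega) q (by omega)), ← ddv_smul, ← ddv_add]
      exact ddv_congr _ _ _ _ fun q _ => by ring
    have a2 : (s - x i * t) * ddv x (fun q => g q * (w q ^ (k - i) * F q)) i
        = ddv x (fun q => w q ^ (k - i + 1) * F q) i + (-t) *
          ddv x (fun q => (1 + (x i - x q) * g q) * (w q ^ (k - i) * F q)) i := by
      rw [← ddv_smul, ← ddv_smul, ← ddv_add]
      refine ddv_congr _ _ _ _ fun q _ => ?_
      rw [pow_succ]
      have : w q = t + g q * (s - x q * t) := rfl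
      generalize w q ^ (k - i) = W
      rw [this]; ring
    have a3 : Mpr x s t (i + 1) = Mpr x s t i * (s - x i * t) := by
      simp [Mpr, Finset.prod_range_succ]
    rw [a1, mul_add]
    have : Mpr x s t (i + 1) * (-1 * ddv x (fun q => g q * (w q ^ (k - i) * F q)) i)
      = - (Mpr x s t i * ((s - x i * t) * ddv x (fun q => g q * (w q ^ (k - i) * F q)) i)) := by
      rw [a3]; ring
    rw [this, a2]; ring
  have e : Hk x g s t F (k + 1) = ∑ i ∈ Finset.range (k + 1 + 1), Mpr x s t i *
    ddv x (fun q => (1 + (x i - x q) * g q) * (w q ^ (k + 1 - i) * F q)) i := rfl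
  rw [e, Finset.sum_range_succ', Finset.sum_congr rfl key, Finset.sum_add_distrib,
    Finset.sum_range_sub, ← Finset.mul_sum]
  have e0 : Mpr x s t 0 *
    ddv x (fun q => (1 + (x 0 - x q) * g q) * (w q ^ (k + 1 - 0) * F q)) 0 = X 0 := by
    simp [hX, ddv]
  have e1 : X (k + 1) = Mpr x s t (k + 1) * ddv x F (k + 1) := by simp [hX]
  rw [e0, e1]
  unfold Hk
  ring

lemma Hk_mul (x g : ℕ → ℂ) (s t : ℂ) (F : ℕ → ℂ) (k : ℕ)
    (h : ∀ i ≤ k + 1, ∀ q < i, x q ≠ x i) :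
    Hk x g s t (fun q => x q * F q) (k + 1) =
      s * Hk x g s t F k + Mpr x s t (k + 1) * (x (k + 1) * ddv x F (k + 1)) := by
  have a1 : ∀ k, (∀ q ≤ k, x q ≠ x (k + 1)) → ddv x (fun q => x q * F q) (k + 1) =
      x (k + 1) * ddv x F (k + 1) + ddv x F k := by
    intro k h
    rw [← ddv_shift x F k h, ← ddv_smul, ← ddv_add]
    exact ddv_congr _ _ _ _ fun q _ => by ring
  induction k with
  | zero =>
    rw [Hk_succ _ _ _ _ _ _ h, a1 0 (fun q hq => h 1 (by omega) q (by omega))]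
    simp [Hk, ddv, Mpr]
    ring
  | succ k ih =>
    rw [Hk_succ _ _ _ _ _ _ h, ih (fun i hi => h i (by omega)),
      a1 (k + 1) (fun q hq => h (k + 1 + 1) (by omega) q (by omega)),
      Hk_succ _ _ _ _ _ k (fun i hi => h i (by omega))]
    have a3 : Mpr x s t (k + 1 + 1) = Mpr x s t (k + 1) * (s - x (k + 1) * t) := by
      simp [Mpr, Finset.prod_range_succ]
    rw [a3]; ring

lemma ddv_pow_zero (x : ℕ → ℂ) (a k : ℕ) (hak : a < k)
    (h : ∀ i ≤ k, ∀ q < i, x q ≠ x i) : ddv x (fun q => x q ^ a) k = 0 := by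
  have hinj : Set.InjOn x (Finset.range (k + 1) : Finset ℕ) := by
    intro i hi j hj hij
    simp only [Finset.coe_range, Set.mem_Iio] at hi hj
    rcases lt_trichotomy i j with hl | hl | hl
    · exact absurd hij (h j (by omega) i hl)
    · exact hl
    · exact absurd hij.symm (h i (by omega) j hl)
  have := Lagrange.coeff_eq_sum hinj (P := (Polynomial.X : Polynomial ℂ) ^ a) (by
    rw [Polynomial.degree_X_pow, Finset.card_range]; exact_mod_cast (by omega))
  rw [Finset.card_range, Nat.add_sub_cancel, Polynomial.coeff_X_pow, if_neg (by omega)] at this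
  rw [this]
  simp [ddv, div_eq_mul_inv]

lemma Hk_pow (x g : ℕ → ℂ) (s t : ℂ) (a k : ℕ) (hak : a ≤ k)
    (h : ∀ i ≤ k, ∀ q < i, x q ≠ x i) :
    Hk x g s t (fun q => x q ^ a) k = s ^ a * t ^ (k - a) := by
  induction a generalizing k with
  | zero =>
    clear hak
    induction k with
    | zero => simp [Hk, ddv, Mpr]
    | succ k ih =>
      rw [Hk_succ _ _ _ _ _ _ h, ih (fun i hi => h i (by omega)), ddv_pow_zero x 0 _ (by omega) h]
      simp [pow_succ]; ring
  | succ a ih =>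
    obtain ⟨k, rfl⟩ : ∃ k', k = k' + 1 := ⟨k - 1, by omega⟩
    have : (fun q => x q ^ (a + 1)) = (fun q => x q * x q ^ a) := by ext; ring
    rw [this, Hk_mul _ _ _ _ _ _ h, ih k (by omega) (fun i hi => h i (by omega)),
      ddv_pow_zero x a _ (by omega) h, Nat.add_sub_add_right]
    ring

lemma EN_reindex (η : ℕ → ℂ) (f : ℂ × ℂ → ℂ) (N : ℕ) (z : ℂ × ℂ) :
    EN η f N z = ∑ i ∈ Finset.range N, Mpr (fun i => η (N - i)) z.1 z.2 i *
      ddv (fun i => η (N - i)) (fun q =>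
        ((1 + η (N - i) * (starRingEnd ℂ) (η (N - q))) / (1 + (Complex.normSq (η (N - q)) : ℂ))) *
            ∑' m : ℕ,
              ((z.2 + (starRingEnd ℂ) (η (N - q)) * z.1) /
                (1 + (Complex.normSq (η (N - q)) : ℂ))) ^ m *
                (((m + i).factorial : ℂ))⁻¹ *
                  iteratedDeriv (m + i) (fun v => f (η (N - q) * v, v)) 0) i := by
  unfold EN
  refine Finset.sum_nbij' (fun p => N - p) (fun i => N - i) ?_ ?_ ?_ ?_ ?_
  · intro p hp; simp only [Finset.mem_Icc, Finset.mem_range] at *; omega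
  · intro p hp; simp only [Finset.mem_Icc, Finset.mem_range] at *; omega
  · intro p hp; simp only [Finset.mem_Icc, Finset.mem_range] at *; omega
  · intro p hp; simp only [Finset.mem_Icc, Finset.mem_range] at *; omega
  intro p hp
  simp only [Finset.mem_Icc] at hp
  congr 1
  · unfold Mpr
    refine Finset.prod_nbij' (fun p => N - p) (fun i => N - i) ?_ ?_ ?_ ?_ ?_
    · intro p hp; simp only [Finset.mem_Icc, Finset.mem_range] at *; omega
    · intro p hp; simp only [Finset.mem_Icc, Finset.mem_range] at *; omega
    · intro p hp; simp only [Finset.mem_Icc, Finset.mem_range] at *; omega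
    · intro p hp; simp only [Finset.mem_Icc, Finset.mem_range] at *; omega
    intro j hj
    simp only [Finset.mem_Icc] at hj
    simp only [Nat.sub_sub_self hj.2]
  · unfold ddv
    refine Finset.sum_nbij' (fun p => N - p) (fun i => N - i) ?_ ?_ ?_ ?_ ?_
    · intro p hp; simp only [Finset.mem_Icc, Finset.mem_range] at *; omega
    · intro p hp; simp only [Finset.mem_Icc, Finset.mem_range] at *; omega
    · intro p hp; simp only [Finset.mem_Icc, Finset.mem_range] at *; omega
    · intro p hp; simp only [Finset.mem_Icc, Finset.mem_range] at *; omega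
    intro q hq
    simp only [Finset.mem_Icc] at hq
    simp only [Nat.sub_sub_self hq.2, Nat.sub_sub_self hp.2]
    have : ∏ j ∈ (Finset.Icc p N).erase q, (η q - η j)
        = ∏ j ∈ (Finset.range (N - p + 1)).erase (N - q), (η q - η (N - j)) := by
      refine Finset.prod_nbij' (fun p => N - p) (fun i => N - i) ?_ ?_ ?_ ?_ ?_
      · intro p hp; simp only [Finset.mem_erase, Finset.mem_Icc, Finset.mem_range] at *; omega
      · intro p hp; simp only [Finset.mem_erase, Finset.mem_Icc, Finset.mem_range] at *; omega
      · intro p hp; simp only [Finset.mem_erase, Finset.mem_Icc, Finset.mem_range] at *; omega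
      · intro p hp; simp only [Finset.mem_erase, Finset.mem_Icc, Finset.mem_range] at *; omega
      intro j hj
      simp only [Finset.mem_erase, Finset.mem_Icc] at hj
      simp only [Nat.sub_sub_self hj.2.2]
    rw [this]
    ring

lemma tsum_poly (P : MvPolynomial (Fin 2) ℂ) (e u : ℂ) (i : ℕ) :
    ∑' m : ℕ, u ^ m * (((m + i).factorial : ℂ))⁻¹ *
      iteratedDeriv (m + i) (fun v => MvPolynomial.eval ![e * v, v] P) 0 =
    ∑ d ∈ P.support, P.coeff d *
      (if i ≤ d 0 + d 1 then u ^ (d 0 + d 1 - i) * e ^ d 0 else 0) := by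
  have h1 : ∀ n, iteratedDeriv n (fun v => MvPolynomial.eval ![e * v, v] P) 0 =
      ∑ d ∈ P.support, P.coeff d * e ^ d 0 * (if n = d 0 + d 1 then (n.factorial : ℂ) else 0) := by
    intro n
    have : (fun v => MvPolynomial.eval ![e * v, v] P) =
        fun v => ∑ d ∈ P.support, (P.coeff d * e ^ d 0) * v ^ (d 0 + d 1) := by
      ext v
      rw [MvPolynomial.eval_eq']
      refine Finset.sum_congr rfl fun d _ => ?_
      simp [Fin.prod_univ_two, mul_pow, pow_add]; ring
    rw [this, iteratedDeriv_fun_sum (fun d _ => by fun_prop)]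
    refine Finset.sum_congr rfl fun d _ => ?_
    rw [iteratedDeriv_const_mul_field, iteratedDeriv_fun_pow_zero]
    congr 1
    split_ifs with h
    · rw [h]
    · simp
  have h2 : ∀ d : Fin 2 →₀ ℕ, HasSum (fun m : ℕ => if m + i = d 0 + d 1 then
      P.coeff d * (u ^ m * e ^ d 0) else 0) (P.coeff d *
      (if i ≤ d 0 + d 1 then u ^ (d 0 + d 1 - i) * e ^ d 0 else 0)) := by
    intro d
    split_ifs with h
    · have := hasSum_single (f := fun m : ℕ => if m + i = d 0 + d 1 then
        P.coeff d * (u ^ m * e ^ d 0) else 0) (d 0 + d 1 - i) (by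
          intro m hm
          rw [if_neg]; omega)
      rwa [if_pos (by omega)] at this
    · rw [mul_zero]
      have : (fun m : ℕ => if m + i = d 0 + d 1 then
        P.coeff d * (u ^ m * e ^ d 0) else 0) = fun _ => 0 := by
        ext m; rw [if_neg]; omega
      rw [this]; exact hasSum_zero
  rw [← (hasSum_sum (s := P.support) (fun d _ => h2 d)).tsum_eq]
  refine tsum_congr fun m => ?_
  rw [h1, Finset.mul_sum]
  refine Finset.sum_congr rfl fun d _ => ?_
  split_ifs
  · have : ((m + i).factorial : ℂ) ≠ 0 := by exact_mod_cast Nat.factorial_ne_zero _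
    field_simp
  · ring

lemma ddv_sum {ι : Type*} (S : Finset ι) (x : ℕ → ℂ) (G : ι → ℕ → ℂ) (i : ℕ) :
    ddv x (fun q => ∑ d ∈ S, G d q) i = ∑ d ∈ S, ddv x (G d) i := by
  simp only [ddv, Finset.sum_mul]
  exact Finset.sum_comm

theorem stmt6 (η : ℕ → ℂ)
    (hdist : ∀ i j, 1 ≤ i → 1 ≤ j → i ≠ j → η i ≠ η j)
    (N : ℕ) (hN : 1 ≤ N)
    (P : MvPolynomial (Fin 2) ℂ) (hP : P.totalDegree ≤ N - 1) (z : ℂ × ℂ) :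
    EN η (fun w => MvPolynomial.eval ![w.1, w.2] P) N z =
      MvPolynomial.eval ![z.1, z.2] P := by
  rw [EN_reindex, MvPolynomial.eval_eq']
  simp only [tsum_poly, Finset.mul_sum, ddv_sum]
  rw [Finset.sum_comm]
  refine Finset.sum_congr rfl fun d hd => ?_
  have hdeg : d 0 + d 1 < N := by
    have := (MvPolynomial.le_totalDegree hd).trans hP
    rw [Finsupp.sum_fintype _ _ (fun _ => rfl), Fin.sum_univ_two] at this
    omega
  set x : ℕ → ℂ := fun i => η (N - i) with hx
  set g : ℕ → ℂ := fun q => (starRingEnd ℂ) (x q) / (1 + (Complex.normSq (x q) : ℂ)) with hg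
  have hD : ∀ q, (1 + (Complex.normSq (x q) : ℂ)) ≠ 0 := by
    intro q
    have := Complex.normSq_nonneg (x q)
    exact_mod_cast (by positivity : (1 + Complex.normSq (x q)) ≠ 0)
  have main := Hk_pow x g z.1 z.2 (d 0) (d 0 + d 1) (by omega) (by
    intro i hi q hq
    exact hdist _ _ (by omega) (by omega) (by omega))
  rw [Fin.prod_univ_two]
  simp only [Matrix.cons_val_zero, Matrix.cons_val_one]
  rw [Nat.add_sub_cancel_left] at main
  rw [← main, Hk, Finset.mul_sum]
  symm
  refine Finset.sum_subset_zero_on_sdiff ?_ ?_ ?_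
  · intro i hi; simp only [Finset.mem_range] at *; omega
  · intro i hi
    simp only [Finset.mem_sdiff, Finset.mem_range] at hi
    have hni : ¬ i ≤ d 0 + d 1 := by omega
    simp [ddv, hni]
  · intro i hi
    simp only [Finset.mem_range] at hi
    have hle : i ≤ d 0 + d 1 := by omega
    simp only [if_pos hle]
    rw [mul_left_comm, ← ddv_smul]
    congr 1
    refine ddv_congr _ _ _ _ fun q _ => ?_
    have e1 : (1 + η (N - i) * (starRingEnd ℂ) (η (N - q))) /
        (1 + (Complex.normSq (η (N - q)) : ℂ)) = 1 + (x i - x q) * g q := by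
      have := hD q
      simp only [hg]
      rw [div_eq_iff this]
      have e := Complex.mul_conj (x q)
      field_simp
      simp only [hx] at e ⊢
      linear_combination e
    have e2 : (z.2 + (starRingEnd ℂ) (η (N - q)) * z.1) /
        (1 + (Complex.normSq (η (N - q)) : ℂ)) = z.2 + g q * (z.1 - x q * z.2) := by
      have := hD q
      simp only [hg]
      rw [div_eq_iff this]
      have e := Complex.mul_conj (x q)
      field_simp
      simp only [hx] at e ⊢
      linear_combination z.2 * e
    rw [e1, e2]
    ring
end

section
/- Let (η_j)_{j≥1} be a sequence of pairwise distinct complex numbers and let f : ℂ² → ℂ be entire with Taylor coefficients (a_{k,l}). Then for every N ≥ 1 and every integer k_1 ≥ N, (1/k_1!) · (∂^{k_1}/∂z_1^{k_1})|_{z=0} [R_N(f;η)(z)] = Δ_{N−1,(η_{N−1},…,η_1)}[ζ ↦ (conj(ζ)/(1+|ζ|²))^{k_1−N+1} · Σ_{k+l=k_1} a_{k,l} ζ^k](η_N). -/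
open Complex Filter

lemma divDiff_eq_aux (η : ℕ → ℂ)
    (hdist : ∀ i j, 1 ≤ i → 1 ≤ j → i ≠ j → η i ≠ η j) (g : ℂ → ℂ) (p : ℕ) :
    ∀ w : ℂ, (∀ i, 1 ≤ i → i ≤ p → w ≠ η i) →
      divDiff η g p w = (∑ i ∈ Finset.Icc 1 p,
        g (η i) * (∏ j ∈ (Finset.Icc 1 p).erase i, (η i - η j))⁻¹ * (η i - w)⁻¹) +
        g w * (∏ j ∈ Finset.Icc 1 p, (w - η j))⁻¹ := by
  induction p with
  | zero => intro w _; simp [divDiff]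
  | succ p ih =>
    intro w hw
    have hwb : w - η (p + 1) ≠ 0 := sub_ne_zero.2 (hw (p+1) (by omega) le_rfl)
    have hnot : p + 1 ∉ Finset.Icc 1 p := by simp
    have hIcc : Finset.Icc 1 (p + 1) = insert (p + 1) (Finset.Icc 1 p) := by
      ext x; simp; omega
    rw [divDiff, ih w (fun i h1 h2 => hw i h1 (by omega)),
      ih (η (p+1)) (fun i h1 h2 => hdist _ _ (by omega) h1 (by omega))]
    rw [hIcc, Finset.sum_insert hnot, Finset.prod_insert hnot, Finset.erase_insert hnot]
    have hsum : ∑ i ∈ Finset.Icc 1 p, g (η i) *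
          (∏ j ∈ (insert (p + 1) (Finset.Icc 1 p)).erase i, (η i - η j))⁻¹ * (η i - w)⁻¹
        = (∑ i ∈ Finset.Icc 1 p, g (η i) *
            (∏ j ∈ (Finset.Icc 1 p).erase i, (η i - η j))⁻¹ * (η i - w)⁻¹
          - ∑ i ∈ Finset.Icc 1 p, g (η i) *
            (∏ j ∈ (Finset.Icc 1 p).erase i, (η i - η j))⁻¹ * (η i - η (p + 1))⁻¹)
            / (w - η (p + 1)) := by
      rw [← Finset.sum_sub_distrib, Finset.sum_div]
      refine Finset.sum_congr rfl fun i hi => ?_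
      have hi' := Finset.mem_Icc.1 hi
      have h1 : η i - w ≠ 0 := sub_ne_zero.2 (hw i hi'.1 (by omega)).symm
      have h2 : η i - η (p + 1) ≠ 0 :=
        sub_ne_zero.2 (hdist _ _ hi'.1 (by omega) (by omega))
      rw [Finset.erase_insert_of_ne (by omega), Finset.prod_insert (by simp), mul_inv]
      field_simp
      ring
    rw [hsum]
    have h3 : η (p + 1) - w = -(w - η (p + 1)) := by ring
    rw [h3, inv_neg, mul_inv]
    generalize (∏ j ∈ Finset.Icc 1 p, (η (p + 1) - η j))⁻¹ = A
    generalize (∏ j ∈ Finset.Icc 1 p, (w - η j))⁻¹ = B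
    field_simp
    ring

lemma inner_hasSum (a : ℕ → ℕ → ℂ) (f : ℂ × ℂ → ℂ)
    (ha : ∀ z : ℂ × ℂ,
      HasSum (fun kl : ℕ × ℕ => a kl.1 kl.2 * z.1 ^ kl.1 * z.2 ^ kl.2) (f z))
    (N : ℕ) (e x : ℂ) :
    HasSum (fun m : ℕ => if N ≤ m then
        (∑ k ∈ Finset.range (m + 1), a k (m - k) * e ^ k) * x ^ (m - N + 1) else 0)
      (∑' kl : ℕ × ℕ, if N ≤ kl.1 + kl.2 then
          a kl.1 kl.2 * e ^ kl.1 * x ^ (kl.1 + kl.2 - N + 1) else 0) := by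
  set F : ℕ × ℕ → ℂ := fun kl => if N ≤ kl.1 + kl.2 then
          a kl.1 kl.2 * e ^ kl.1 * x ^ (kl.1 + kl.2 - N + 1) else 0 with hF
  have hs : Summable F := by
    by_cases hx : x = 0
    · have : F = fun _ => 0 := by
        funext kl; simp [hF, hx]
      rw [this]; exact summable_zero
    · have h1 : Summable ({kl : ℕ × ℕ | N ≤ kl.1 + kl.2}.indicator
          (fun kl : ℕ × ℕ => a kl.1 kl.2 * (e * x) ^ kl.1 * x ^ kl.2)) :=
        (ha (e * x, x)).summable.indicator _
      have h2 := h1.mul_left (x * (x ^ N)⁻¹)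
      refine h2.congr fun kl => ?_
      by_cases h : N ≤ kl.1 + kl.2
      · simp only [hF, Set.indicator, Set.mem_ofPred_eq, h, if_true]
        have h4 : x ^ (kl.1 + kl.2 - N + 1) = x * (x ^ N)⁻¹ * (x ^ kl.1 * x ^ kl.2) := by
          rw [← pow_add, pow_succ, pow_sub₀ _ hx h]; ring
        rw [h4, mul_pow]; ring
      · simp [hF, h]
  have h5 : HasSum (F ∘ Finset.HasAntidiagonal.sigmaAntidiagonalEquivProd) (∑' kl, F kl) :=
    (Equiv.hasSum_iff Finset.HasAntidiagonal.sigmaAntidiagonalEquivProd).2 hs.hasSum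
  have h6 := h5.sigma (fun m => hasSum_fintype _)
  convert h6 using 2 with m
  have h7 : ∑ b : Finset.HasAntidiagonal.antidiagonal m,
      (F ∘ Finset.HasAntidiagonal.sigmaAntidiagonalEquivProd) ⟨m, b⟩
      = ∑ b ∈ Finset.HasAntidiagonal.antidiagonal m, F b := by
    exact Finset.sum_coe_sort (Finset.HasAntidiagonal.antidiagonal m) F
  rw [h7, Finset.Nat.sum_antidiagonal_eq_sum_range_succ_mk]
  have h8 : ∀ k ∈ Finset.range (m + 1), k + (m - k) = m := by
    intro k hk
    have := Finset.mem_range.1 hk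
    omega
  split_ifs with hm
  · rw [Finset.sum_mul]
    refine Finset.sum_congr rfl fun k hk => ?_
    simp [hF, h8 k hk, hm]
  · symm
    refine Finset.sum_eq_zero fun k hk => ?_
    simp only [hF, h8 k hk, hm, if_false]

lemma RN_hasSum (η : ℕ → ℂ) (f : ℂ × ℂ → ℂ)
    (a : ℕ → ℕ → ℂ)
    (ha : ∀ z : ℂ × ℂ,
      HasSum (fun kl : ℕ × ℕ => a kl.1 kl.2 * z.1 ^ kl.1 * z.2 ^ kl.2) (f z))
    (N : ℕ) (hN : 1 ≤ N) (w : ℂ) :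
    HasSum (fun m : ℕ => w ^ m • (∑ p ∈ Finset.Icc 1 N,
        (∏ j ∈ (Finset.Icc 1 N).erase p, (η p - η j))⁻¹ *
         if N ≤ m then
          ((starRingEnd ℂ) (η p) / (1 + (Complex.normSq (η p) : ℂ))) ^ (m - N + 1) *
          ∑ k ∈ Finset.range (m + 1), a k (m - k) * η p ^ k else 0)) (RN η a N (w, 0)) := by
  unfold RN
  simp only [Finset.smul_sum]
  refine hasSum_sum fun p hp => ?_
  have h := (inner_hasSum a f ha N (η p)
    ((0 + (starRingEnd ℂ) (η p) * w) / (1 + (Complex.normSq (η p) : ℂ)))).mul_left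
    (∏ j ∈ (Finset.Icc 1 N).erase p, ((w - η j * 0) / (η p - η j)))
  refine (congrArg (fun F => HasSum F _) (funext fun m => ?_)).mpr h
  rw [Finset.prod_div_distrib]
  simp only [mul_zero, sub_zero, Finset.prod_const, Finset.card_erase_of_mem hp, Nat.card_Icc,
    zero_add, smul_eq_mul, Nat.add_sub_cancel]
  split_ifs with hm
  · have h4 : w ^ m = w ^ (N - 1) * w ^ (m - N + 1) := by
      rw [← pow_add]; congr 1; omega
    rw [h4, mul_div_right_comm, mul_pow]; ring
  · simp

theorem stmt12 (η : ℕ → ℂ)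
    (hdist : ∀ i j, 1 ≤ i → 1 ≤ j → i ≠ j → η i ≠ η j)
    (f : ℂ × ℂ → ℂ) (hf : Differentiable ℂ f)
    (a : ℕ → ℕ → ℂ)
    (ha : ∀ z : ℂ × ℂ,
      HasSum (fun kl : ℕ × ℕ => a kl.1 kl.2 * z.1 ^ kl.1 * z.2 ^ kl.2) (f z))
    (N k₁ : ℕ) (hN : 1 ≤ N) (hk₁ : N ≤ k₁) :
    ((k₁.factorial : ℂ))⁻¹ * iteratedDeriv k₁ (fun w => RN η a N (w, 0)) 0 =
      divDiff η
        (fun ζ => ((starRingEnd ℂ) ζ / (1 + (Complex.normSq ζ : ℂ))) ^ (k₁ - N + 1) *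
          ∑ k ∈ Finset.range (k₁ + 1), a k (k₁ - k) * ζ ^ k)
        (N - 1) (η N) := by
  have hsum := RN_hasSum η f a ha N hN
  set c : ℕ → ℂ := fun m => ∑ p ∈ Finset.Icc 1 N,
        (∏ j ∈ (Finset.Icc 1 N).erase p, (η p - η j))⁻¹ *
         if N ≤ m then
          ((starRingEnd ℂ) (η p) / (1 + (Complex.normSq (η p) : ℂ))) ^ (m - N + 1) *
          ∑ k ∈ Finset.range (m + 1), a k (m - k) * η p ^ k else 0 with hc
  have hps : HasFPowerSeriesAt (fun w => RN η a N (w, 0))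
      (FormalMultilinearSeries.ofScalars ℂ c) 0 := by
    rw [hasFPowerSeriesAt_iff]
    refine Eventually.of_forall fun z => ?_
    have hz : HasSum (fun m => z ^ m • c m) (RN η a N (z, 0)) := hsum z
    simp only [FormalMultilinearSeries.coeff_ofScalars, zero_add]
    exact hz
  obtain ⟨r, hr⟩ := hps
  have hd := hr.factorial_smul 1 k₁
  have hder : iteratedDeriv k₁ (fun w => RN η a N (w, 0)) 0 = (k₁.factorial : ℂ) * c k₁ := by
    rw [iteratedDeriv_eq_iteratedFDeriv, ← hd]
    simp [FormalMultilinearSeries.ofScalars]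
  rw [hder, inv_mul_cancel_left₀ (by exact_mod_cast k₁.factorial_ne_zero)]
  obtain ⟨M, rfl⟩ : ∃ M, N = M + 1 := ⟨N - 1, by omega⟩
  rw [Nat.add_sub_cancel, divDiff_eq_aux η hdist _ M (η (M + 1))
    (fun i h1 h2 => hdist _ _ (by omega) h1 (by omega))]
  have hnot : M + 1 ∉ Finset.Icc 1 M := by simp
  have hIcc : Finset.Icc 1 (M + 1) = insert (M + 1) (Finset.Icc 1 M) := by
    ext x; simp; omega
  simp only [hc, hk₁, if_true]
  rw [hIcc, Finset.sum_insert hnot, Finset.erase_insert hnot, add_comm]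
  congr 1
  · refine Finset.sum_congr rfl fun i hi => ?_
    have hi' := Finset.mem_Icc.1 hi
    rw [Finset.erase_insert_of_ne (by omega), Finset.prod_insert (by simp), mul_inv]
    ring
  · ring
end

section
/- Let (η_j)_{j≥1} be a sequence of pairwise distinct complex numbers and let f : ℂ² → ℂ be entire with Taylor coefficients (a_{k,l}). Then for every N ≥ 1 and every z ∈ ℂ², R_N(f;η)(z) = Σ_{p=0}^{N−1} z_2^{N−1−p} (∏_{j=1}^p (z_1 − η_j z_2)) · Δ_{p,(η_p,…,η_1)}[ζ ↦ Σ_{m≥N} ((z_2 + conj(ζ) z_1)/(1 + |ζ|²))^{m−N+1} · Σ_{k+l=m} a_{k,l} ζ^k](η_{p+1}). -/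
open Complex Filter

theorem prod_erase_succ (F : ℕ → ℂ) (p i : ℕ) (hi : i ∈ Finset.Icc 1 p) :
    ∏ j ∈ (Finset.Icc 1 (p + 1)).erase i, F j = F (p + 1) * ∏ j ∈ (Finset.Icc 1 p).erase i, F j := by
  have hi' := Finset.mem_Icc.1 hi
  have h : (Finset.Icc 1 (p + 1)).erase i = insert (p + 1) ((Finset.Icc 1 p).erase i) := by
    ext x
    simp only [Finset.mem_erase, Finset.mem_insert, Finset.mem_Icc]
    omega
  rw [h, Finset.prod_insert]
  simp

theorem prod_erase_last (F : ℕ → ℂ) (p : ℕ) :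
    ∏ j ∈ (Finset.Icc 1 (p + 1)).erase (p + 1), F j = ∏ j ∈ Finset.Icc 1 p, F j := by
  congr 1
  ext x
  simp only [Finset.mem_erase, Finset.mem_Icc]
  omega

theorem divDiff_formula (η : ℕ → ℂ)
    (hdist : ∀ i j, 1 ≤ i → 1 ≤ j → i ≠ j → η i ≠ η j) (g : ℂ → ℂ) (p : ℕ) :
    ∀ w : ℂ, (∀ j ∈ Finset.Icc 1 p, w ≠ η j) →
    divDiff η g p w = g w / ∏ j ∈ Finset.Icc 1 p, (w - η j) +
      ∑ i ∈ Finset.Icc 1 p,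
        g (η i) / ((∏ j ∈ (Finset.Icc 1 p).erase i, (η i - η j)) * (η i - w)) := by
  induction p with
  | zero => intro w _; simp [divDiff]
  | succ p ih =>
    intro w hw
    have hw1 : w - η (p + 1) ≠ 0 := sub_ne_zero.2 (hw _ (by simp))
    have hw2 : η (p + 1) - w ≠ 0 := sub_ne_zero.2 (hw _ (by simp)).symm
    have hP : ∏ j ∈ Finset.Icc 1 p, (η (p + 1) - η j) ≠ 0 := by
      refine Finset.prod_ne_zero_iff.2 fun j hj => sub_ne_zero.2 ?_
      have := Finset.mem_Icc.1 hj
      exact hdist _ _ (by omega) (by omega) (by omega)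
    have hmem : ∀ j ∈ Finset.Icc 1 p, j ∈ Finset.Icc 1 (p + 1) := by
      intro j hj
      have := Finset.mem_Icc.1 hj
      exact Finset.mem_Icc.2 ⟨by omega, by omega⟩
    rw [divDiff, ih w (fun j hj => hw j (hmem j hj)), ih (η (p + 1))]
    swap
    · intro j hj
      have := Finset.mem_Icc.1 hj
      exact hdist _ _ (by omega) (by omega) (by omega)
    rw [Finset.sum_Icc_succ_top (by omega), Finset.prod_Icc_succ_top (by omega), prod_erase_last]
    have hs : ∑ i ∈ Finset.Icc 1 p, g (η i) /
          ((∏ j ∈ (Finset.Icc 1 (p + 1)).erase i, (η i - η j)) * (η i - w)) =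
        (∑ i ∈ Finset.Icc 1 p,
          g (η i) / ((∏ j ∈ (Finset.Icc 1 p).erase i, (η i - η j)) * (η i - w)) -
        ∑ i ∈ Finset.Icc 1 p,
          g (η i) / ((∏ j ∈ (Finset.Icc 1 p).erase i, (η i - η j)) * (η i - η (p + 1)))) /
          (w - η (p + 1)) := by
      rw [← Finset.sum_sub_distrib, Finset.sum_div]
      refine Finset.sum_congr rfl fun i hi => ?_
      rw [prod_erase_succ _ _ _ hi]
      have hi' := Finset.mem_Icc.1 hi
      have h1 : η i - w ≠ 0 := sub_ne_zero.2 (hw i (hmem i hi)).symm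
      have h2 : η i - η (p + 1) ≠ 0 :=
        sub_ne_zero.2 (hdist _ _ (by omega) (by omega) (by omega))
      have h3 : ∏ j ∈ (Finset.Icc 1 p).erase i, (η i - η j) ≠ 0 := by
        refine Finset.prod_ne_zero_iff.2 fun j hj => sub_ne_zero.2 ?_
        have hj1 := Finset.mem_erase.1 hj
        have := Finset.mem_Icc.1 hj1.2
        exact hdist _ _ (by omega) (by omega) (Ne.symm hj1.1)
      field_simp
      ring
    rw [hs]
    have hQ : ∏ j ∈ Finset.Icc 1 p, (w - η j) ≠ 0 :=
      Finset.prod_ne_zero_iff.2 fun j hj => sub_ne_zero.2 (hw j (hmem j hj))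
    have hneg : η (p + 1) - w = -(w - η (p + 1)) := by ring
    rw [hneg]
    field_simp
    ring

theorem lagrange_newton (η : ℕ → ℂ)
    (hdist : ∀ i j, 1 ≤ i → 1 ≤ j → i ≠ j → η i ≠ η j) (g : ℂ → ℂ) (x y : ℂ) (N : ℕ) :
    ∑ p ∈ Finset.Icc 1 (N + 1),
      (∏ j ∈ (Finset.Icc 1 (N + 1)).erase p, ((x - η j * y) / (η p - η j))) * g (η p) =
    ∑ p ∈ Finset.range (N + 1),
      y ^ (N - p) * (∏ j ∈ Finset.Icc 1 p, (x - η j * y)) * divDiff η g p (η (p + 1)) := by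
  induction N with
  | zero => simp [divDiff]
  | succ N ih =>
    rw [Finset.sum_range_succ]
    have h1 : ∑ p ∈ Finset.range (N + 1),
        y ^ (N + 1 - p) * (∏ j ∈ Finset.Icc 1 p, (x - η j * y)) * divDiff η g p (η (p + 1)) =
        y * ∑ p ∈ Finset.range (N + 1),
          y ^ (N - p) * (∏ j ∈ Finset.Icc 1 p, (x - η j * y)) * divDiff η g p (η (p + 1)) := by
      rw [Finset.mul_sum]
      refine Finset.sum_congr rfl fun p hp => ?_
      have := Finset.mem_range.1 hp
      rw [show N + 1 - p = (N - p) + 1 by omega, pow_succ]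
      ring
    rw [h1, ← ih, divDiff_formula η hdist g (N + 1)]
    swap
    · intro j hj
      have := Finset.mem_Icc.1 hj
      exact hdist _ _ (by omega) (by omega) (by omega)
    rw [Finset.sum_Icc_succ_top (by omega), prod_erase_last, Finset.prod_div_distrib, mul_add,
      Finset.mul_sum, Finset.mul_sum]
    have hs : ∑ p ∈ Finset.Icc 1 (N + 1),
        (∏ j ∈ (Finset.Icc 1 (N + 1 + 1)).erase p, ((x - η j * y) / (η p - η j))) * g (η p) =
        ∑ i ∈ Finset.Icc 1 (N + 1),
          y * ((∏ j ∈ (Finset.Icc 1 (N + 1)).erase i, ((x - η j * y) / (η i - η j))) * g (η i)) +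
        ∑ i ∈ Finset.Icc 1 (N + 1), y ^ (N + 1 - (N + 1)) *
          (∏ j ∈ Finset.Icc 1 (N + 1), (x - η j * y)) *
          (g (η i) / ((∏ j ∈ (Finset.Icc 1 (N + 1)).erase i, (η i - η j)) *
            (η i - η (N + 1 + 1)))) := by
      rw [← Finset.sum_add_distrib]
      refine Finset.sum_congr rfl fun i hi => ?_
      rw [prod_erase_succ _ _ _ hi, Finset.prod_div_distrib,
        ← Finset.mul_prod_erase _ _ hi]
      have hi' := Finset.mem_Icc.1 hi
      have h2 : η i - η (N + 1 + 1) ≠ 0 :=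
        sub_ne_zero.2 (hdist _ _ (by omega) (by omega) (by omega))
      have h3 : ∏ j ∈ (Finset.Icc 1 (N + 1)).erase i, (η i - η j) ≠ 0 := by
        refine Finset.prod_ne_zero_iff.2 fun j hj => sub_ne_zero.2 ?_
        have hj1 := Finset.mem_erase.1 hj
        have := Finset.mem_Icc.1 hj1.2
        exact hdist _ _ (by omega) (by omega) (Ne.symm hj1.1)
      rw [Nat.sub_self, pow_zero]
      field_simp
      ring
    rw [hs, Nat.sub_self, pow_zero]
    ring

theorem tsum_regroup (a : ℕ → ℕ → ℂ)
    (ha : ∀ z : ℂ × ℂ,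
      Summable (fun kl : ℕ × ℕ => a kl.1 kl.2 * z.1 ^ kl.1 * z.2 ^ kl.2))
    (N : ℕ) (ζ w : ℂ) :
    (∑' kl : ℕ × ℕ, if N ≤ kl.1 + kl.2 then
        a kl.1 kl.2 * ζ ^ kl.1 * w ^ (kl.1 + kl.2 - N + 1) else 0) =
    ∑' m : ℕ, if N ≤ m then
      w ^ (m - N + 1) * ∑ k ∈ Finset.range (m + 1), a k (m - k) * ζ ^ k else 0 := by
  have hsum : Summable (fun kl : ℕ × ℕ => if N ≤ kl.1 + kl.2 then
        a kl.1 kl.2 * ζ ^ kl.1 * w ^ (kl.1 + kl.2 - N + 1) else 0) := by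
    by_cases hw : w = 0
    · subst hw
      simp [summable_zero]
    · have h := ((ha (ζ * w, w)).indicator {kl : ℕ × ℕ | N ≤ kl.1 + kl.2}).mul_left (w / w ^ N)
      refine h.congr fun kl => ?_
      by_cases hk : N ≤ kl.1 + kl.2
      · rw [Set.indicator_of_mem (by exact hk), if_pos hk]
        have : w ^ kl.1 * w ^ kl.2 = w ^ (kl.1 + kl.2 - N) * w ^ N := by
          rw [← pow_add, ← pow_add]
          congr 1
          omega
        rw [pow_succ]
        simp only [mul_pow]
        field_simp
        linear_combination (a kl.1 kl.2 * ζ ^ kl.1) * this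
      · rw [Set.indicator_of_notMem (by exact hk), if_neg hk, mul_zero]
  rw [← Finset.HasAntidiagonal.sigmaAntidiagonalEquivProd.tsum_eq]
  refine (((Finset.HasAntidiagonal.sigmaAntidiagonalEquivProd.summable_iff).2 hsum).tsum_sigma'
      (fun n => (hasSum_fintype _).summable)).trans ?_
  refine tsum_congr fun m => ?_
  rw [tsum_fintype]
  rw [Finset.univ_eq_attach]
  refine (Finset.sum_attach (Finset.HasAntidiagonal.antidiagonal m) (fun kl : ℕ × ℕ => if N ≤ kl.1 + kl.2 then
        a kl.1 kl.2 * ζ ^ kl.1 * w ^ (kl.1 + kl.2 - N + 1) else 0)).trans ?_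
  rw [Finset.Nat.sum_antidiagonal_eq_sum_range_succ_mk]
  by_cases hm : N ≤ m
  · rw [if_pos hm, Finset.mul_sum]
    refine Finset.sum_congr rfl fun k hk => ?_
    have := Finset.mem_range.1 hk
    have e : k + (m - k) = m := by omega
    simp only [e, if_pos hm]
    ring
  · rw [if_neg hm]
    refine Finset.sum_eq_zero fun k hk => ?_
    have := Finset.mem_range.1 hk
    rw [if_neg (by simp only; omega)]

theorem stmt13 (η : ℕ → ℂ)
    (hdist : ∀ i j, 1 ≤ i → 1 ≤ j → i ≠ j → η i ≠ η j)
    (f : ℂ × ℂ → ℂ) (hf : Differentiable ℂ f)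
    (a : ℕ → ℕ → ℂ)
    (ha : ∀ z : ℂ × ℂ,
      HasSum (fun kl : ℕ × ℕ => a kl.1 kl.2 * z.1 ^ kl.1 * z.2 ^ kl.2) (f z))
    (N : ℕ) (hN : 1 ≤ N) (z : ℂ × ℂ) :
    RN η a N z =
      ∑ p ∈ Finset.range N,
        z.2 ^ (N - 1 - p) * (∏ j ∈ Finset.Icc 1 p, (z.1 - η j * z.2)) *
          divDiff η
            (fun ζ => ∑' m : ℕ,
              if N ≤ m then
                ((z.2 + (starRingEnd ℂ) ζ * z.1) /
                    (1 + (Complex.normSq ζ : ℂ))) ^ (m - N + 1) *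
                  ∑ k ∈ Finset.range (m + 1), a k (m - k) * ζ ^ k
              else 0)
            p (η (p + 1)) := by
  obtain ⟨M, rfl⟩ : ∃ M, N = M + 1 := ⟨N - 1, by omega⟩
  have h := lagrange_newton η hdist (fun ζ => ∑' m : ℕ,
              if M + 1 ≤ m then
                ((z.2 + (starRingEnd ℂ) ζ * z.1) /
                    (1 + (Complex.normSq ζ : ℂ))) ^ (m - (M + 1) + 1) *
                  ∑ k ∈ Finset.range (m + 1), a k (m - k) * ζ ^ k
              else 0) z.1 z.2 M
  rw [Nat.add_sub_cancel, ← h, RN]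
  refine Finset.sum_congr rfl fun p _ => ?_
  rw [tsum_regroup a (fun z => (ha z).summable)]
end
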